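/- For every h > 0, the integrals I_{−3}(h) = ∫_{β(h)}^{α(h)} (1+y)^{−3} √(h + h y − y²) dy and I_0(h) = ∫_{β(h)}^{α(h)} √(h + h y − y²) dy are equal, and both equal π h (4+h)/8. -/

import Mathlib

open intervalIntegral Real

/-- The area of the upper half of the disc with center `(h / 2, 0)` and radius `√(h * (4 + h)) / 2`. -/
theorem integral_sqrt_add_mul_sub_sq (h : ℝ) (hh : 0 < h) :
    (∫ y in ((h - √(h * (4 + h))) / 2)..((h + √(h * (4 + h))) / 2), √(h + h * y - y ^ 2))
      = π * h * (4 + h) / 8 := by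
  set s := √(h * (4 + h))
  have hs2 : s ^ 2 = h * (4 + h) := Real.sq_sqrt (by positivity)
  have hs0 : 0 ≤ s := Real.sqrt_nonneg _
  have key := smul_integral_comp_mul_add (a := -1) (b := 1)
    (fun y : ℝ => √(h + h * y - y ^ 2)) (s / 2) (h / 2)
  have scale (t : ℝ) :
      √(h + h * (s / 2 * t + h / 2) - (s / 2 * t + h / 2) ^ 2) = s / 2 * √(1 - t ^ 2) := by
    rw [← Real.sqrt_sq (by positivity : 0 ≤ s / 2), ← Real.sqrt_mul (by positivity),
      Real.sqrt_sq (by positivity)]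
    congr 1
    linear_combination -hs2 / 4
  simp only [scale, intervalIntegral.integral_const_mul, integral_sqrt_one_sub_sq,
    smul_eq_mul] at key
  rw [show (h - s) / 2 = s / 2 * -1 + h / 2 by ring,
    show (h + s) / 2 = s / 2 * 1 + h / 2 by ring, ← key]
  linear_combination π / 8 * hs2

/-- The substitution `1 + y ↦ (1 + y)⁻¹` swaps the endpoints and preserves the radicand up to the
factor `(1 + y) ^ 2`. -/
theorem integral_zpow_neg_three_mul_sqrt (h : ℝ) (hh : 0 < h) :
    (∫ y in ((h - √(h * (4 + h))) / 2)..((h + √(h * (4 + h))) / 2),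
        (1 + y) ^ (-3 : ℤ) * √(h + h * y - y ^ 2))
      = ∫ y in ((h - √(h * (4 + h))) / 2)..((h + √(h * (4 + h))) / 2),
          √(h + h * y - y ^ 2) := by
  set s := √(h * (4 + h))
  have hs2 : s ^ 2 = h * (4 + h) := Real.sq_sqrt (by positivity)
  have hs0 : 0 ≤ s := Real.sqrt_nonneg _
  have hsh : s < h + 2 := by nlinarith
  have hpos {y : ℝ} (hy : y ∈ Set.uIcc ((h - s) / 2) ((h + s) / 2)) : 0 < 1 + y := by
    rw [Set.uIcc_of_le (by linarith)] at hy
    linarith [hy.1]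
  have key := integral_comp_mul_deriv (a := (h - s) / 2) (b := (h + s) / 2)
    (f := fun y => (1 + y)⁻¹ - 1) (f' := fun y => -1 / (1 + y) ^ 2)
    (g := fun y => √(h + h * y - y ^ 2))
    (fun y hy => (((hasDerivAt_id y).const_add 1).inv (hpos hy).ne').sub_const 1)
    (continuousOn_const.div (by fun_prop) fun y hy => (pow_pos (hpos hy) 2).ne')
    (by fun_prop)
  have hβ : (1 + (h - s) / 2)⁻¹ - 1 = (h + s) / 2 := by
    rw [sub_eq_iff_eq_add]
    exact inv_eq_of_mul_eq_one_right (by linear_combination -hs2 / 4)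
  have hα : (1 + (h + s) / 2)⁻¹ - 1 = (h - s) / 2 := by
    rw [sub_eq_iff_eq_add]
    exact inv_eq_of_mul_eq_one_right (by linear_combination -hs2 / 4)
  simp only [hα, hβ] at key
  rw [integral_symm ((h - s) / 2) ((h + s) / 2), ← neg_eq_iff_eq_neg,
    ← intervalIntegral.integral_neg] at key
  rw [← key]
  refine integral_congr fun y hy => ?_
  have hy := hpos hy
  have hrad : h + h * ((1 + y)⁻¹ - 1) - ((1 + y)⁻¹ - 1) ^ 2
      = (h + h * y - y ^ 2) / (1 + y) ^ 2 := by
    field_simp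
    ring
  simp only [Function.comp, hrad, Real.sqrt_div' _ (sq_nonneg (1 + y)), Real.sqrt_sq hy.le]
  rw [show (-3 : ℤ) = -((3 : ℕ) : ℤ) by norm_num, zpow_neg, zpow_natCast]
  field_simp

/-- For `h > 0`, with `α(h) = (h + √(h(4+h)))/2` and
`β(h) = (h − √(h(4+h)))/2`, the integrals
`I₋₃(h) = ∫_{β(h)}^{α(h)} (1+y)⁻³ √(h + h y − y²) dy` and
`I₀(h) = ∫_{β(h)}^{α(h)} √(h + h y − y²) dy` are equal, and both equal `π h (4+h) / 8`. -/
theorem stmt1 (h : ℝ) (hh : 0 < h) :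
    (∫ y in ((h - Real.sqrt (h * (4 + h))) / 2)..((h + Real.sqrt (h * (4 + h))) / 2),
        (1 + y) ^ (-3 : ℤ) * Real.sqrt (h + h * y - y ^ 2))
      = (∫ y in ((h - Real.sqrt (h * (4 + h))) / 2)..((h + Real.sqrt (h * (4 + h))) / 2),
          Real.sqrt (h + h * y - y ^ 2)) ∧
    (∫ y in ((h - Real.sqrt (h * (4 + h))) / 2)..((h + Real.sqrt (h * (4 + h))) / 2),
        Real.sqrt (h + h * y - y ^ 2))
      = Real.pi * h * (4 + h) / 8 := by
  exact ⟨integral_zpow_neg_three_mul_sqrt h hh, integral_sqrt_add_mul_sub_sq h hh⟩
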